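/- arXiv:2408.13558 — 2 statements merged into one kernel-verified Lean document; each statement's English description precedes it below -/
import Mathlib

section
/- Let α, β, γ be integers with β ≥ γ > 1 and α + 1 ≥ 2γ, and let G be a finite group of order 2^(α+β+1) together with elements a, b, c such that G is generated by {a, b, c}, a and c commute, the commutator [a,b] equals a^(2^(α−γ)) · c, the commutator [c,b] equals a^(−2^(2(α−γ))) · c^(−2^(α−γ)), orderOf a = 2^α, orderOf b = 2^β, orderOf c = 2, orderOf [a,b] = 2^γ, the cyclic subgroups ⟨a⟩ and ⟨c⟩ intersect trivially, and the subgroups ⟨a, c⟩ and ⟨b⟩ intersect trivially (this is the group G₃ with σ = 1). Then the ordered Davenport constant of G equals its Loewy length: D_o(G) = L(G) = 2^α + 2^β + 1. -/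
/-- A list (ordered sequence) over `G` is product-one free if no nonempty
order-preserving sublist has product equal to the identity. -/
def OrderedProductOneFree {G : Type*} [Group G] (l : List G) : Prop :=
  ∀ t : List G, t.Sublist l → t ≠ [] → t.prod ≠ 1

/-- The ordered Davenport constant: the smallest `k` such that every list of
elements of `G` of length at least `k` has a nonempty sublist with product one. -/
noncomputable def orderedDavenport (G : Type*) [Group G] : ℕ :=
  sInf {k : ℕ | ∀ l : List G, k ≤ l.length → ¬ OrderedProductOneFree l}
/-- The Loewy length of a finite `p`-group `G`: the least positive integer `n` such that
the `n`-th power of the Jacobson radical of the group algebra `𝔽_p[G]` vanishes. -/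
noncomputable def loewyLength (p : ℕ) (G : Type*) [Group G] : ℕ :=
  sInf {n : ℕ | 0 < n ∧ (Ideal.jacobson (⊥ : Ideal (MonoidAlgebra (ZMod p) G))) ^ n = ⊥}

section WeightFiltration

variable (k : Type*) {R : Type*} [CommRing k] [Ring R] [Algebra k R]

/-- The span of the monomials `A ^ i * C ^ j` of weight `i + 2 * j` at least `n`. -/
def weightSpan (A C : R) (n : ℕ) : Submodule k R :=
  Submodule.span k {x | ∃ i j, n ≤ i + 2 * j ∧ x = A ^ i * C ^ j}

/-- The span of the monomials `B ^ l * A ^ i * C ^ j` of weight `l + i + 2 * j` at least `n`. -/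
def weightSpan₃ (A B C : R) (n : ℕ) : Submodule k R :=
  Submodule.span k {x | ∃ l m, n ≤ l + m ∧ ∃ y ∈ weightSpan k A C m, x = B ^ l * y}

variable {k} {A B C : R}

theorem weightSpan_anti {m n : ℕ} (h : m ≤ n) : weightSpan k A C n ≤ weightSpan k A C m :=
  Submodule.span_mono fun _ ⟨i, j, hij, hx⟩ => ⟨i, j, h.trans hij, hx⟩

theorem weightSpan₃_anti {m n : ℕ} (h : m ≤ n) :
    weightSpan₃ k A B C n ≤ weightSpan₃ k A B C m :=
  Submodule.span_mono fun _ ⟨l, i, hl, hx⟩ => ⟨l, i, h.trans hl, hx⟩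

theorem pow_mul_pow_mem_weightSpan {n i j : ℕ} (h : n ≤ i + 2 * j) :
    A ^ i * C ^ j ∈ weightSpan k A C n :=
  Submodule.subset_span ⟨i, j, h, rfl⟩

theorem one_mem_weightSpan : (1 : R) ∈ weightSpan k A C 0 := by
  simpa using pow_mul_pow_mem_weightSpan (k := k) (A := A) (C := C) (n := 0) (i := 0) (j := 0)
    (by simp)

theorem left_pow_mem_weightSpan {n i : ℕ} (h : n ≤ i) : A ^ i ∈ weightSpan k A C n := by
  simpa using pow_mul_pow_mem_weightSpan (k := k) (A := A) (C := C) (n := n) (i := i) (j := 0)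
    (by simpa using h)

theorem left_mem_weightSpan : A ∈ weightSpan k A C 1 := by
  simpa using left_pow_mem_weightSpan (k := k) (A := A) (C := C) (n := 1) (i := 1) le_rfl

theorem right_mem_weightSpan : C ∈ weightSpan k A C 2 := by
  simpa using pow_mul_pow_mem_weightSpan (k := k) (A := A) (C := C) (n := 2) (i := 0) (j := 1)
    (by simp)

theorem mul_mem_weightSpan (hAC : Commute A C) {m n : ℕ} {x y : R}
    (hx : x ∈ weightSpan k A C m) (hy : y ∈ weightSpan k A C n) :
    x * y ∈ weightSpan k A C (m + n) := by
  have h := Submodule.mul_mem_mul hx hy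
  rw [weightSpan, weightSpan, Submodule.span_mul_span] at h
  refine Submodule.span_mono ?_ h
  rintro _ ⟨_, ⟨i, j, hij, rfl⟩, _, ⟨i', j', hij', rfl⟩, rfl⟩
  refine ⟨i + i', j + j', by omega, ?_⟩
  have := (hAC.pow_pow i' j).eq
  simp only [pow_add, mul_assoc]
  rw [← mul_assoc (C ^ j), ← this]
  simp only [mul_assoc]

theorem weightSpan_eq_bot {M n : ℕ} (hA : A ^ M = 0) (hC : C ^ 2 = 0) (hn : M + 2 ≤ n) :
    weightSpan k A C n = ⊥ := by
  rw [weightSpan, Submodule.span_eq_bot]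
  rintro _ ⟨i, j, hij, rfl⟩
  rcases Nat.lt_or_ge j 2 with hj | hj
  · rw [pow_eq_zero_of_le (by omega) hA, zero_mul]
  · rw [pow_eq_zero_of_le hj hC, mul_zero]

theorem weightSpan₃_eq_bot {M N n : ℕ} (hA : A ^ M = 0) (hB : B ^ N = 0) (hC : C ^ 2 = 0)
    (hn : M + N + 1 ≤ n) : weightSpan₃ k A B C n = ⊥ := by
  rw [weightSpan₃, Submodule.span_eq_bot]
  rintro _ ⟨l, m, hlm, y, hy, rfl⟩
  rcases Nat.lt_or_ge l N with hl | hl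
  · rw [weightSpan_eq_bot hA hC (by omega), Submodule.mem_bot] at hy
    rw [hy, mul_zero]
  · rw [pow_eq_zero_of_le hl hB, zero_mul]

/-- `x` has weight at least `n`, and conjugation by `b` changes `x` only by an element of weight
at least `n + 1`. -/
def ConjStable (k : Type*) [CommRing k] [Algebra k R] (A C b : R) (n : ℕ) (x : R) : Prop :=
  x ∈ weightSpan k A C n ∧ ∃ d ∈ weightSpan k A C (n + 1), x * b = b * (x + d)

variable {b : R}

theorem conjStable_one : ConjStable k A C b 0 1 :=
  ⟨one_mem_weightSpan, 0, zero_mem _, by simp⟩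

theorem ConjStable.mul (hAC : Commute A C) {m n : ℕ} {x y : R} (hx : ConjStable k A C b m x)
    (hy : ConjStable k A C b n y) : ConjStable k A C b (m + n) (x * y) := by
  obtain ⟨hx, d, hd, hxd⟩ := hx
  obtain ⟨hy, e, he, hye⟩ := hy
  refine ⟨mul_mem_weightSpan hAC hx hy, x * e + d * y + d * e, ?_, ?_⟩
  · refine add_mem (add_mem ?_ ?_) ?_
    · exact weightSpan_anti (by omega) (mul_mem_weightSpan hAC hx he)
    · exact weightSpan_anti (by omega) (mul_mem_weightSpan hAC hd hy)
    · exact weightSpan_anti (by omega) (mul_mem_weightSpan hAC hd he)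
  · rw [mul_assoc, hye, ← mul_assoc, hxd]
    noncomm_ring

theorem ConjStable.pow (hAC : Commute A C) {m : ℕ} {x : R} (hx : ConjStable k A C b m x) (i : ℕ) :
    ConjStable k A C b (i * m) (x ^ i) := by
  induction i with
  | zero => simpa using conjStable_one
  | succ i ih => rw [pow_succ, Nat.succ_mul]; exact ih.mul hAC hx

theorem ConjStable.anti {m n : ℕ} (h : m ≤ n) {x : R} (hx : ConjStable k A C b n x) :
    ConjStable k A C b m x :=
  ⟨weightSpan_anti h hx.1, hx.2.imp fun _ hd => ⟨weightSpan_anti (by omega) hd.1, hd.2⟩⟩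

theorem conjStable_of_mem_weightSpan (hAC : Commute A C) (hA : ConjStable k A C b 1 A)
    (hC : ConjStable k A C b 2 C) {n : ℕ} {x : R} (hx : x ∈ weightSpan k A C n) :
    ConjStable k A C b n x := by
  induction hx using Submodule.span_induction with
  | mem x hx =>
    obtain ⟨i, j, hij, rfl⟩ := hx
    exact ((hA.pow hAC i).mul hAC (hC.pow hAC j)).anti (by omega)
  | zero => exact ⟨zero_mem _, 0, zero_mem _, by simp⟩
  | add x y _ _ hx hy =>
    obtain ⟨hx, d, hd, hxd⟩ := hx
    obtain ⟨hy, e, he, hye⟩ := hy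
    refine ⟨add_mem hx hy, d + e, add_mem hd he, ?_⟩
    rw [add_mul, hxd, hye]
    noncomm_ring
  | smul r x _ hx =>
    obtain ⟨hx, d, hd, hxd⟩ := hx
    refine ⟨Submodule.smul_mem _ _ hx, r • d, Submodule.smul_mem _ _ hd, ?_⟩
    rw [smul_mul_assoc, hxd, ← smul_add, mul_smul_comm]

theorem mul_mem_weightSpan₃_of_weightSpan {s : ℕ} {z : R}
    (hz : ∀ m, ∀ y ∈ weightSpan k A C m, ∀ l, B ^ l * (y * z) ∈ weightSpan₃ k A B C (l + m + s))
    {n : ℕ} {x : R} (hx : x ∈ weightSpan₃ k A B C n) : x * z ∈ weightSpan₃ k A B C (n + s) := by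
  induction hx using Submodule.span_induction with
  | mem x hx =>
    obtain ⟨l, m, hlm, y, hy, rfl⟩ := hx
    rw [mul_assoc]
    exact weightSpan₃_anti (by omega) (hz m y hy l)
  | zero => rw [zero_mul]; exact zero_mem _
  | add x y _ _ hx hy => rw [add_mul]; exact add_mem hx hy
  | smul r x _ hx => rw [smul_mul_assoc]; exact Submodule.smul_mem _ _ hx

theorem pow_mul_mem_weightSpan₃ {n l m : ℕ} (h : n ≤ l + m) {y : R}
    (hy : y ∈ weightSpan k A C m) : B ^ l * y ∈ weightSpan₃ k A B C n :=
  Submodule.subset_span ⟨l, m, h, y, hy, rfl⟩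

theorem weightSpan₃_mul_left (hAC : Commute A C) {n : ℕ} {x : R}
    (hx : x ∈ weightSpan₃ k A B C n) : x * A ∈ weightSpan₃ k A B C (n + 1) :=
  mul_mem_weightSpan₃_of_weightSpan (fun _ _ hy _ => pow_mul_mem_weightSpan₃ (by omega)
    (mul_mem_weightSpan hAC hy left_mem_weightSpan)) hx

theorem weightSpan₃_mul_right (hAC : Commute A C) {n : ℕ} {x : R}
    (hx : x ∈ weightSpan₃ k A B C n) : x * C ∈ weightSpan₃ k A B C (n + 1) :=
  weightSpan₃_anti (by omega) <| mul_mem_weightSpan₃_of_weightSpan (s := 2)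
    (fun _ _ hy _ => pow_mul_mem_weightSpan₃ (by omega)
      (mul_mem_weightSpan hAC hy right_mem_weightSpan)) hx

theorem weightSpan₃_mul_middle (hAC : Commute A C) (hA : ConjStable k A C (B + 1) 1 A)
    (hC : ConjStable k A C (B + 1) 2 C) {n : ℕ} {x : R}
    (hx : x ∈ weightSpan₃ k A B C n) : x * B ∈ weightSpan₃ k A B C (n + 1) := by
  refine mul_mem_weightSpan₃_of_weightSpan (fun m y hy l => ?_) hx
  obtain ⟨-, d, hd, hyd⟩ := conjStable_of_mem_weightSpan hAC hA hC hy
  have key : y * B = B * y + B * d + d := by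
    rw [mul_add, mul_one] at hyd
    rw [eq_sub_of_add_eq hyd]
    noncomm_ring
  rw [key, mul_add, mul_add, ← mul_assoc, ← mul_assoc, ← pow_succ]
  exact add_mem (add_mem (pow_mul_mem_weightSpan₃ (by omega) hy)
    (pow_mul_mem_weightSpan₃ (by omega) hd)) (pow_mul_mem_weightSpan₃ (by omega) hd)

theorem one_mem_weightSpan₃ : (1 : R) ∈ weightSpan₃ k A B C 0 := by
  simpa using pow_mul_mem_weightSpan₃ (k := k) (B := B) (l := 0) (Nat.zero_le _)
    (one_mem_weightSpan (k := k) (A := A) (C := C))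

end WeightFiltration

namespace MonoidAlgebra

section Augmentation

variable {k G : Type*} [CommRing k] [Group G]

/-- If each generator of a finite group raises a filtration, so does the augmentation ideal. -/
theorem mul_mem_of_lift_one_eq_zero [Finite G] {s : Set G} (hs : Subgroup.closure s = ⊤)
    {W : ℕ → Submodule k (MonoidAlgebra k G)} (hW : ∀ n, W (n + 1) ≤ W n)
    (hmul : ∀ g ∈ s, ∀ n, ∀ x ∈ W n, x * (of k G g - 1) ∈ W (n + 1))
    {n : ℕ} {x y : MonoidAlgebra k G} (hx : x ∈ W n)
    (hy : lift k k G (1 : G →* k) y = 0) : x * y ∈ W (n + 1) := by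
  have hgen (g : G) : ∀ n, ∀ x ∈ W n, x * (of k G g - 1) ∈ W (n + 1) := by
    have hg : g ∈ Submonoid.closure s := by
      rw [← Subgroup.closure_toSubmonoid_of_finite, hs]; trivial
    induction hg using Submonoid.closure_induction with
    | mem g hg => exact hmul g hg
    | one => intro n x _; rw [map_one, sub_self, mul_zero]; exact zero_mem _
    | mul g h _ _ ihg ihh =>
      intro n x hx
      have : x * (of k G (g * h) - 1) = x * (of k G g - 1) * (of k G h - 1) +
          x * (of k G g - 1) + x * (of k G h - 1) := by
        rw [map_mul]; noncomm_ring
      rw [this]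
      exact add_mem (add_mem (hW _ (ihh _ _ (ihg _ _ hx))) (ihg _ _ hx)) (ihh _ _ hx)
  have hsub (z : MonoidAlgebra k G) :
      x * (z - algebraMap k _ (lift k k G (1 : G →* k) z)) ∈ W (n + 1) := by
    induction z using MonoidAlgebra.induction_on with
    | of g =>
      rw [lift_of, MonoidHom.one_apply, map_one]
      exact hgen g n x hx
    | add z w hz hw =>
      rw [map_add, map_add, add_sub_add_comm, mul_add]
      exact add_mem hz hw
    | smul r z hz =>
      rw [map_smul, smul_eq_mul, map_mul, ← Algebra.smul_def, ← smul_sub, mul_smul_comm]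
      exact Submodule.smul_mem _ _ hz
  simpa [hy] using hsub y

theorem mem_of_one_mem_filtration [Finite G] {s : Set G} (hs : Subgroup.closure s = ⊤)
    {W : ℕ → Submodule k (MonoidAlgebra k G)} (hW : ∀ n, W (n + 1) ≤ W n)
    (hmul : ∀ g ∈ s, ∀ n, ∀ x ∈ W n, x * (of k G g - 1) ∈ W (n + 1))
    (hone : (1 : MonoidAlgebra k G) ∈ W 0) (z : MonoidAlgebra k G) : z ∈ W 0 := by
  have h := hW 0 (mul_mem_of_lift_one_eq_zero hs hW hmul hone
    (y := z - algebraMap k _ (lift k k G (1 : G →* k) z)) (by simp))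
  rw [one_mul] at h
  have := add_mem h ((W 0).smul_mem (lift k k G (1 : G →* k) z) hone)
  rwa [← Algebra.algebraMap_eq_smul_one, sub_add_cancel] at this

end Augmentation

theorem lift_one_eq_zero_of_mem_jacobson {k G : Type*} [Field k] [Group G]
    {x : MonoidAlgebra k G} (hx : x ∈ Ideal.jacobson (⊥ : Ideal (MonoidAlgebra k G))) :
    lift k k G (1 : G →* k) x = 0 := by
  by_contra h
  obtain ⟨z, hz⟩ := Ideal.mem_jacobson_iff.1 hx
    (algebraMap k _ (-(lift k k G (1 : G →* k) x)⁻¹))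
  rw [Ideal.mem_bot] at hz
  have := congrArg (lift k k G (1 : G →* k)) hz
  rw [map_sub, map_add, map_mul, map_mul, AlgHom.commutes,
    map_one (lift k k G (1 : G →* k)), map_zero, Algebra.algebraMap_self, RingHom.id_apply, mul_assoc,
    neg_mul, inv_mul_cancel₀ h] at this
  simp at this

/-- A product-one free list gives a nonzero product of the elements `g - 1`. -/
theorem prod_map_of_sub_one_ne_zero (k : Type*) {G : Type*} [CommRing k] [Nontrivial k] [Group G]
    {l : List G} (hl : OrderedProductOneFree l) : (l.map fun g => of k G g - 1).prod ≠ 0 := by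
  let S (l : List G) : Submodule k (MonoidAlgebra k G) :=
    Submodule.span k {x | ∃ t : List G, t.Sublist l ∧ t ≠ [] ∧ x = of k G t.prod}
  have hS : ∀ l : List G, (l.map fun g => of k G g - 1).prod - (-1) ^ l.length ∈ S l := by
    intro l
    induction l with
    | nil => simp
    | cons g l ih =>
      have hmono : S l ≤ S (g :: l) := Submodule.span_mono fun x ⟨t, ht, hx⟩ =>
        ⟨t, ht.trans (List.sublist_cons_self g l), hx⟩
      have hmul : ∀ x ∈ S l, of k G g * x ∈ S (g :: l) := by
        intro x hx
        induction hx using Submodule.span_induction with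
        | mem x hx =>
          obtain ⟨t, ht, -, rfl⟩ := hx
          exact Submodule.subset_span ⟨g :: t, ht.cons_cons g, by simp, by
            rw [List.prod_cons, map_mul]⟩
        | zero => rw [mul_zero]; exact zero_mem _
        | add x y _ _ hx hy => rw [mul_add]; exact add_mem hx hy
        | smul r x _ hx => rw [mul_smul_comm]; exact Submodule.smul_mem _ _ hx
      have hg : of k G g ∈ S (g :: l) :=
        Submodule.subset_span ⟨[g], by simp, by simp, by simp⟩
      have hg' : of k G g * (-1) ^ l.length ∈ S (g :: l) := by
        rcases neg_one_pow_eq_or (MonoidAlgebra k G) l.length with h | h <;> rw [h]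
        · simpa using hg
        · simpa using hg
      have : ((g :: l).map fun g => of k G g - 1).prod - (-1) ^ (g :: l).length =
          of k G g * ((l.map fun g => of k G g - 1).prod - (-1) ^ l.length) -
          ((l.map fun g => of k G g - 1).prod - (-1) ^ l.length) +
          of k G g * (-1) ^ l.length := by
        rw [List.map_cons, List.prod_cons, List.length_cons, pow_succ]
        noncomm_ring
      rw [this]
      exact add_mem (sub_mem (hmul _ ih) (hmono ih)) hg'
  intro h0
  have hcoeff : ∀ x ∈ S l, x.coeff 1 = 0 := by
    intro x hx
    induction hx using Submodule.span_induction with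
    | mem x hx =>
      obtain ⟨t, ht, hne, rfl⟩ := hx
      simp [of_apply, hl t ht hne]
    | zero => simp
    | add x y _ _ hx hy => simp [hx, hy]
    | smul r x _ hx => simp [hx]
  have h1 := hcoeff _ (hS l)
  rw [h0, zero_sub] at h1
  rcases neg_one_pow_eq_or (MonoidAlgebra k G) l.length with h | h <;> rw [h] at h1 <;>
    simp [one_def] at h1

end MonoidAlgebra

theorem Ideal.list_prod_mem_pow {R : Type*} [Ring R] {I : Ideal R} :
    ∀ {l : List R}, (∀ x ∈ l, x ∈ I) → l.prod ∈ I ^ l.length := by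
  intro l
  induction l using List.reverseRecOn with
  | nil => intro _; simp [Submodule.pow_zero, Ideal.one_eq_top]
  | append_singleton l x ih =>
    intro h
    rw [List.prod_append, List.length_append, List.length_singleton, List.prod_singleton,
      Submodule.pow_succ]
    exact Ideal.mul_mem_mul (ih fun y hy => h y (by simp [hy])) (h x (by simp))

theorem Ideal.pow_eq_bot_of_le {R : Type*} [Ring R] {I : Ideal R} {m n : ℕ} (h : m ≤ n)
    (hm : I ^ m = ⊥) : I ^ n = ⊥ := by
  induction n, h using Nat.le_induction with
  | base => exact hm
  | succ n _ ih => rw [Submodule.pow_succ, ih, Submodule.bot_mul]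

open MonoidAlgebra in
/-- If the group algebra has a filtration raised by the augmentation ideal and vanishing in degree
`N + 1`, and `G` has a product-one free list of length `N`, then both invariants are `N + 1`. -/
theorem orderedDavenport_and_loewyLength_eq {p : ℕ} [Fact p.Prime] {G : Type*} [Group G] [Finite G]
    {s : Set G} (hs : Subgroup.closure s = ⊤)
    {W : ℕ → Submodule (ZMod p) (MonoidAlgebra (ZMod p) G)} (hW : ∀ n, W (n + 1) ≤ W n)
    (hmul : ∀ g ∈ s, ∀ n, ∀ x ∈ W n, x * (of (ZMod p) G g - 1) ∈ W (n + 1))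
    (hone : (1 : MonoidAlgebra (ZMod p) G) ∈ W 0) {N : ℕ} (hbot : W (N + 1) = ⊥)
    {l : List G} (hl : OrderedProductOneFree l) (hlen : l.length = N) :
    orderedDavenport G = N + 1 ∧ loewyLength p G = N + 1 := by
  set J := Ideal.jacobson (⊥ : Ideal (MonoidAlgebra (ZMod p) G))
  have hJ : ∀ n, ∀ x ∈ J ^ n, x ∈ W n := by
    intro n
    induction n with
    | zero => exact fun x _ => mem_of_one_mem_filtration hs hW hmul hone x
    | succ n ih =>
      intro x hx
      rw [Submodule.pow_succ] at hx
      refine Submodule.mul_induction_on hx (fun y hy z hz => ?_) fun _ _ => add_mem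
      exact mul_mem_of_lift_one_eq_zero hs hW hmul (ih y hy)
        (lift_one_eq_zero_of_mem_jacobson hz)
  have hJbot : J ^ (N + 1) = ⊥ := by
    rw [eq_bot_iff]
    intro x hx
    have := hJ _ x hx
    rwa [hbot, Submodule.mem_bot] at this
  have hnil (x : MonoidAlgebra (ZMod p) G) (hx : lift (ZMod p) (ZMod p) G 1 x = 0) :
      IsNilpotent x := by
    have hpow : ∀ n, x ^ n ∈ W n := by
      intro n
      induction n with
      | zero => simpa using hone
      | succ n ih => rw [pow_succ]; exact mul_mem_of_lift_one_eq_zero hs hW hmul ih hx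
    have := hpow (N + 1)
    rw [hbot, Submodule.mem_bot] at this
    exact ⟨_, this⟩
  have hmem (g : G) : of (ZMod p) G g - 1 ∈ J := by
    refine Ideal.mem_jacobson_iff.2 fun y => ?_
    obtain ⟨u, hu⟩ := (hnil (y * (of (ZMod p) G g - 1)) (by simp)).isUnit_one_add
    refine ⟨↑u⁻¹, ?_⟩
    have := u.inv_mul
    rw [hu, mul_add, mul_one, ← mul_assoc] at this
    rw [Ideal.mem_bot, add_comm (_ * _) (_ : MonoidAlgebra (ZMod p) G), this, sub_self]
  have hfree (l : List G) (hl : OrderedProductOneFree l) : J ^ l.length ≠ ⊥ := by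
    intro h
    have := Ideal.list_prod_mem_pow (I := J) (l := l.map fun g => of (ZMod p) G g - 1) (by
      intro x hx
      obtain ⟨g, -, rfl⟩ := List.mem_map.1 hx
      exact hmem g)
    rw [List.length_map, h, Ideal.mem_bot] at this
    exact prod_map_of_sub_one_ne_zero _ hl this
  constructor
  · refine IsLeast.csInf_eq ⟨fun t ht hft => ?_, fun n hn => ?_⟩
    · exact hfree t hft (Ideal.pow_eq_bot_of_le ht hJbot)
    · by_contra! hlt
      exact hn l (by omega) hl
  · refine IsLeast.csInf_eq ⟨⟨Nat.succ_pos _, hJbot⟩, fun n hn => ?_⟩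
    by_contra! hlt
    exact hfree l hl (Ideal.pow_eq_bot_of_le (by omega) hn.2)

/-- An extremal product-one free list, given that `b` conjugates `a * c` into `⟨a⟩`. -/
theorem orderedProductOneFree_of_conj_mem {G : Type*} [Group G] {a b c : G} {M N : ℕ}
    (ha : orderOf a = M) (hb : orderOf b = N) (hN : 0 < N) (hM : 0 < M)
    (hc : c ∉ Subgroup.zpowers a) (hbac : b⁻¹ * (a * c) * b ∈ Subgroup.zpowers a)
    (hint : Subgroup.closure {a, c} ⊓ Subgroup.zpowers b = ⊥) :
    OrderedProductOneFree
      (List.replicate (M - 1) a ++ (List.replicate (N - 1) b ++ [a * c, b * c])) := by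
  have haN : a ∈ Subgroup.closure {a, c} := Subgroup.subset_closure (by simp)
  have hcN : c ∈ Subgroup.closure {a, c} := Subgroup.subset_closure (by simp)
  have haZ : a ∈ Subgroup.zpowers a := Subgroup.mem_zpowers a
  have hle : Subgroup.zpowers a ≤ Subgroup.closure {a, c} := by simpa using haN
  have hbpow (x y : G) (hx : x ∈ Subgroup.closure {a, c}) (hy : y ∈ Subgroup.closure {a, c})
      (n : ℕ) (h : x * b ^ n * y = 1) : b ^ n = 1 := by
    have hmem : b ^ n ∈ Subgroup.closure {a, c} ⊓ Subgroup.zpowers b := by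
      refine Subgroup.mem_inf.2 ⟨?_, Subgroup.npow_mem_zpowers b n⟩
      have : b ^ n = x⁻¹ * y⁻¹ := by
        rw [eq_mul_inv_iff_mul_eq]
        exact eq_inv_of_mul_eq_one_right (by rw [← mul_assoc, h])
      rw [this]
      exact mul_mem (inv_mem hx) (inv_mem hy)
    rwa [hint, Subgroup.mem_bot] at hmem
  have hmul (x y : G) (hx : x ∈ Subgroup.zpowers a) (hy : y ∈ Subgroup.zpowers a) (n : ℕ)
      (h : x * b ^ n * (y * c) = 1) : False := by
    have h1 := hbpow x (y * c) (hle hx) (mul_mem (hle hy) hcN) n h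
    rw [h1, mul_one, ← mul_assoc] at h
    rw [eq_inv_of_mul_eq_one_right h] at hc
    exact hc (inv_mem (mul_mem hx hy))
  intro t ht hne hprod
  obtain ⟨t₁, t', rfl, ht₁, ht'⟩ := List.sublist_append_iff.1 ht
  obtain ⟨t₂, t₃, rfl, ht₂, ht₃⟩ := List.sublist_append_iff.1 ht'
  obtain ⟨i, hi, rfl⟩ := List.sublist_replicate_iff.1 ht₁
  obtain ⟨j, hj, rfl⟩ := List.sublist_replicate_iff.1 ht₂
  have hai : a ^ i ∈ Subgroup.zpowers a := Subgroup.npow_mem_zpowers a i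
  rw [List.prod_append, List.prod_append, List.prod_replicate, List.prod_replicate,
    ← mul_assoc] at hprod
  have hcases : t₃ = [] ∨ t₃ = [a * c] ∨ t₃ = [b * c] ∨ t₃ = [a * c, b * c] := by
    have : t₃ ∈ [a * c, b * c].sublists' := List.mem_sublists'.2 ht₃
    simp at this
    tauto
  rcases hcases with rfl | rfl | rfl | rfl
  · rw [List.prod_nil] at hprod
    have hbj := hbpow _ _ (hle hai) (one_mem _) j hprod
    have hj0 : j = 0 := by
      by_contra h
      exact pow_ne_one_of_lt_orderOf h (by omega) hbj
    rw [hbj, mul_one, mul_one] at hprod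
    have hi0 : i = 0 := by
      by_contra h
      exact pow_ne_one_of_lt_orderOf h (by omega) hprod
    subst hi0 hj0
    simp at hne
  · rw [List.prod_singleton] at hprod
    exact hmul _ _ hai haZ j hprod
  · rw [List.prod_singleton] at hprod
    refine hmul _ 1 hai (one_mem _) (j + 1) (Eq.trans ?_ hprod)
    simp [pow_succ, mul_assoc]
  · refine hmul _ _ hai hbac (j + 1) (Eq.trans ?_ hprod)
    simp [pow_succ, mul_assoc]

open MonoidAlgebra in
theorem of_sub_one_pow_two_pow {G : Type*} [Group G] (g : G) (n : ℕ) :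
    (of (ZMod 2) G g - 1) ^ 2 ^ n = of (ZMod 2) G (g ^ 2 ^ n) - 1 := by
  have : CharP (MonoidAlgebra (ZMod 2) G) 2 :=
    charP_of_injective_algebraMap (algebraMap (ZMod 2) (MonoidAlgebra (ZMod 2) G)).injective 2
  rw [sub_pow_char_pow_of_commute 2 n (Commute.one_right _), one_pow, map_pow]

section Conjugation

open MonoidAlgebra

variable {G : Type*} [Group G] {a b c : G} {s : ℕ}

theorem of_sub_one_conjStable_left (hac : Commute a c) (hs : 1 ≤ s)
    (hab : a * b = b * (a * (a ^ 2 ^ s * c))) :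
    ConjStable (ZMod 2) (of (ZMod 2) G a - 1) (of (ZMod 2) G c - 1) (of (ZMod 2) G b) 1
      (of (ZMod 2) G a - 1) := by
  set A := of (ZMod 2) G a - 1 with hA
  set C := of (ZMod 2) G c - 1 with hC
  have hAC : Commute A C :=
    ((hac.map (of (ZMod 2) G)).sub_left (Commute.one_left _)).sub_right (Commute.one_right _)
  have ha : of (ZMod 2) G a = A + 1 := by rw [hA, sub_add_cancel]
  have hc : of (ZMod 2) G c = C + 1 := by rw [hC, sub_add_cancel]
  refine ⟨left_mem_weightSpan, (A + 1) * (A ^ 2 ^ s * (C + 1) + C), ?_, ?_⟩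
  · have hs2 : 2 ≤ 2 ^ s := by simpa using Nat.pow_le_pow_right (n := 2) (by simp) hs
    have h1 : A + 1 ∈ weightSpan (ZMod 2) A C 0 :=
      add_mem (weightSpan_anti (by simp) left_mem_weightSpan) one_mem_weightSpan
    have h2 : C + 1 ∈ weightSpan (ZMod 2) A C 0 :=
      add_mem (weightSpan_anti (by simp) right_mem_weightSpan) one_mem_weightSpan
    simpa using mul_mem_weightSpan hAC h1 (add_mem
      (mul_mem_weightSpan hAC (left_pow_mem_weightSpan hs2) h2) right_mem_weightSpan)
  · have hpow : of (ZMod 2) G (a ^ 2 ^ s) = A ^ 2 ^ s + 1 := by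
      rw [hA, of_sub_one_pow_two_pow, sub_add_cancel]
    have := congrArg (of (ZMod 2) G) hab
    rw [map_mul, map_mul, map_mul, map_mul, hpow, hc, ha] at this
    rw [eq_sub_of_add_eq ((add_one_mul A _).symm.trans this)]
    noncomm_ring

theorem of_sub_one_conjStable_right (hac : Commute a c) (hs : 2 ≤ s)
    (hcb : c * b = b * (c * a ^ 2 ^ s)) :
    ConjStable (ZMod 2) (of (ZMod 2) G a - 1) (of (ZMod 2) G c - 1) (of (ZMod 2) G b) 2
      (of (ZMod 2) G c - 1) := by
  set A := of (ZMod 2) G a - 1 with hA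
  set C := of (ZMod 2) G c - 1 with hC
  have hAC : Commute A C :=
    ((hac.map (of (ZMod 2) G)).sub_left (Commute.one_left _)).sub_right (Commute.one_right _)
  have hc : of (ZMod 2) G c = C + 1 := by rw [hC, sub_add_cancel]
  refine ⟨right_mem_weightSpan, (C + 1) * A ^ 2 ^ s, ?_, ?_⟩
  · have hs4 : 4 ≤ 2 ^ s := by simpa using Nat.pow_le_pow_right (n := 2) (by simp) hs
    have h2 : C + 1 ∈ weightSpan (ZMod 2) A C 0 :=
      add_mem (weightSpan_anti (by simp) right_mem_weightSpan) one_mem_weightSpan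
    simpa using mul_mem_weightSpan hAC h2
      (left_pow_mem_weightSpan (n := 3) (by omega : 3 ≤ 2 ^ s))
  · have hpow : of (ZMod 2) G (a ^ 2 ^ s) = A ^ 2 ^ s + 1 := by
      rw [hA, of_sub_one_pow_two_pow, sub_add_cancel]
    have := congrArg (of (ZMod 2) G) hcb
    rw [map_mul, map_mul, map_mul, hpow, hc] at this
    rw [eq_sub_of_add_eq ((add_one_mul C _).symm.trans this)]
    noncomm_ring

end Conjugation

/-- For the group `G₃` with `σ = 1` (so `β ≥ γ > 1`, `α + 1 ≥ 2γ`,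
`o(c) = 2`), the ordered Davenport constant equals the Loewy length:
`D_o(G) = L(G) = 2^α + 2^β + 1`. -/
theorem orderedDavenport_eq_loewyLength_G3 (α β γ : ℕ) (h1 : γ ≤ β) (h2 : 1 < γ)
    (h3 : 2 * γ ≤ α + 1)
    (G : Type*) [Group G] [Fintype G] (a b c : G)
    (hcard : Fintype.card G = 2 ^ (α + β + 1))
    (hgen : Subgroup.closure {a, b, c} = ⊤)
    (hac : a * c = c * a)
    (hab : a⁻¹ * b⁻¹ * a * b = a ^ (2 ^ (α - γ)) * c)
    (hcb : c⁻¹ * b⁻¹ * c * b = a ^ (-(2 ^ (2 * (α - γ)) : ℤ)) * c ^ (-(2 ^ (α - γ) : ℤ)))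
    (hoa : orderOf a = 2 ^ α) (hob : orderOf b = 2 ^ β) (hoc : orderOf c = 2)
    (hoab : orderOf (a⁻¹ * b⁻¹ * a * b) = 2 ^ γ)
    (hint1 : Subgroup.zpowers a ⊓ Subgroup.zpowers c = ⊥)
    (hint2 : Subgroup.closure {a, c} ⊓ Subgroup.zpowers b = ⊥) :
    orderedDavenport G = loewyLength 2 G ∧ loewyLength 2 G = 2 ^ α + 2 ^ β + 1 := by
  have hs : 1 ≤ α - γ := by omega
  have hc2 : c ^ 2 = 1 := by rw [← hoc, pow_orderOf_eq_one]
  have hab' : a * b = b * (a * (a ^ 2 ^ (α - γ) * c)) := by rw [← hab]; group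
  have hcb' : c * b = b * (c * a ^ 2 ^ (2 * (α - γ))) := by
    have hcpow : c ^ (-(2 ^ (α - γ) : ℤ)) = 1 := by
      have : c ^ 2 ^ (α - γ) = 1 := by
        obtain ⟨r, hr⟩ := dvd_pow_self 2 (by omega : α - γ ≠ 0)
        rw [hr, pow_mul, hc2, one_pow]
      rw [zpow_neg, inv_eq_one]
      exact_mod_cast this
    have hapow : a ^ (-(2 ^ (2 * (α - γ)) : ℤ)) = a ^ 2 ^ (2 * (α - γ)) := by
      have h : a ^ 2 ^ (2 * (α - γ)) * a ^ 2 ^ (2 * (α - γ)) = 1 := by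
        rw [← pow_add, ← two_mul, ← pow_succ', ← orderOf_dvd_iff_pow_eq_one, hoa]
        exact pow_dvd_pow 2 (by omega)
      rw [zpow_neg]
      refine inv_eq_of_mul_eq_one_left ?_
      exact_mod_cast h
    rw [← hapow, ← mul_one (a ^ _), ← hcpow, ← hcb]; group
  have hAC : Commute (MonoidAlgebra.of (ZMod 2) G a - 1) (MonoidAlgebra.of (ZMod 2) G c - 1) :=
    ((Commute.map hac (MonoidAlgebra.of (ZMod 2) G)).sub_left (Commute.one_left _)).sub_right
      (Commute.one_right _)
  have hnil {g : G} {n : ℕ} (h : orderOf g = 2 ^ n) :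
      (MonoidAlgebra.of (ZMod 2) G g - 1) ^ 2 ^ n = 0 := by
    rw [of_sub_one_pow_two_pow, ← h, pow_orderOf_eq_one, map_one, sub_self]
  have hfree := orderedProductOneFree_of_conj_mem (c := c) hoa hob (by positivity) (by positivity)
    (fun h => by
      have h' : c ∈ Subgroup.zpowers a ⊓ Subgroup.zpowers c := ⟨h, Subgroup.mem_zpowers c⟩
      rw [hint1, Subgroup.mem_bot] at h'
      rw [h', orderOf_one] at hoc
      omega)
    (by
      have : b⁻¹ * (a * c) * b = a * a ^ 2 ^ (α - γ) * a ^ 2 ^ (2 * (α - γ)) := by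
        calc b⁻¹ * (a * c) * b = b⁻¹ * a * (c * b) := by group
          _ = b⁻¹ * (a * b) * (c * a ^ 2 ^ (2 * (α - γ))) := by rw [hcb']; group
          _ = a * a ^ 2 ^ (α - γ) * c ^ 2 * a ^ 2 ^ (2 * (α - γ)) := by
            rw [hab', pow_two]; group
          _ = _ := by rw [hc2, mul_one]
      rw [this]
      exact mul_mem (mul_mem (Subgroup.mem_zpowers a) (Subgroup.npow_mem_zpowers a _))
        (Subgroup.npow_mem_zpowers a _)) hint2
  have hb1 : MonoidAlgebra.of (ZMod 2) G b - 1 + 1 = MonoidAlgebra.of (ZMod 2) G b :=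
    sub_add_cancel _ _
  obtain ⟨hD, hL⟩ := orderedDavenport_and_loewyLength_eq (p := 2) (N := 2 ^ α + 2 ^ β) hgen
    (W := weightSpan₃ (ZMod 2) (MonoidAlgebra.of (ZMod 2) G a - 1)
      (MonoidAlgebra.of (ZMod 2) G b - 1) (MonoidAlgebra.of (ZMod 2) G c - 1))
    (fun n => weightSpan₃_anti n.le_succ)
    (by
      rintro g (rfl | rfl | rfl) n x hx
      · exact weightSpan₃_mul_left hAC hx
      · refine weightSpan₃_mul_middle hAC ?_ ?_ hx <;> rw [hb1]
        · exact of_sub_one_conjStable_left hac hs hab'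
        · exact of_sub_one_conjStable_right hac (by omega) hcb'
      · exact weightSpan₃_mul_right hAC hx)
    one_mem_weightSpan₃
    (weightSpan₃_eq_bot (hnil hoa) (hnil hob) (hnil (n := 1) (by simpa using hoc)) le_rfl)
    hfree
    (by
      have := Nat.one_le_two_pow (n := α)
      have := Nat.one_le_two_pow (n := β)
      simp only [List.length_append, List.length_replicate, List.length_cons, List.length_nil]
      omega)
  exact ⟨hD.trans hL.symm, hL⟩
end

section
/- Let γ ≥ 1 be an integer and let G be a finite group of order 2^(3γ) together with elements a, b, c such that G is generated by {a, b, c}, a and c commute, orderOf a = orderOf b = 2^(γ+1), orderOf c = 2^(γ−1), orderOf [a,b] = 2^γ, the commutator [a,b] = a⁻¹b⁻¹ab equals a² · c, the commutator [c,b] equals a⁻⁴ · c⁻², and a^(2^γ) = b^(2^γ) (this is the group G₄ = (⟨c⟩ × ⟨a⟩)⟨b⟩). Then the Loewy length of G satisfies L(G) = 2^(γ+2) − 3. -/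
lemma pow_eq_pow_mod_mul {M : Type*} [Monoid M] {x z : M} {q h : ℕ} (hx : x ^ q = z ^ h) (i : ℕ) :
    x ^ i = x ^ (i % q) * z ^ (h * (i / q)) := by
  conv_lhs => rw [← Nat.mod_add_div i q, pow_add, pow_mul, hx, ← pow_mul]

section WeightFiltration

variable {k A : Type*} [CommRing k] [Ring A] [Algebra k A]

/-- The span of the monomials `X ^ i * Y ^ j * Z ^ l` of weight at least `n`, where `X` and `Y`
have weight one and `Z` has weight two. -/
def weightFiltration (k : Type*) {A : Type*} [CommRing k] [Ring A] [Algebra k A]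
    (X Y Z : A) (n : ℕ) : Submodule k A :=
  Submodule.span k {x | ∃ i j l : ℕ, n ≤ i + j + 2 * l ∧ x = X ^ i * Y ^ j * Z ^ l}

namespace weightFiltration

variable {X Y Z : A} {m n : ℕ} {x : A}

lemma monomial_mem {i j l : ℕ} (h : n ≤ i + j + 2 * l) :
    X ^ i * Y ^ j * Z ^ l ∈ weightFiltration k X Y Z n :=
  Submodule.subset_span ⟨i, j, l, h, rfl⟩

lemma antitone (h : m ≤ n) : weightFiltration k X Y Z n ≤ weightFiltration k X Y Z m := by
  refine Submodule.span_mono ?_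
  rintro _ ⟨i, j, l, hn, rfl⟩
  exact ⟨i, j, l, h.trans hn, rfl⟩

lemma map_mem (f : A →ₗ[k] A) (d : ℕ)
    (h : ∀ i j l, n ≤ i + j + 2 * l →
      f (X ^ i * Y ^ j * Z ^ l) ∈ weightFiltration k X Y Z (n + d))
    (hx : x ∈ weightFiltration k X Y Z n) : f x ∈ weightFiltration k X Y Z (n + d) := by
  have : weightFiltration k X Y Z n ≤ (weightFiltration k X Y Z (n + d)).comap f := by
    refine Submodule.span_le.2 ?_
    rintro _ ⟨i, j, l, hn, rfl⟩
    exact h i j l hn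
  exact this hx

lemma pow_X_mul_mem (d : ℕ) (hx : x ∈ weightFiltration k X Y Z n) :
    X ^ d * x ∈ weightFiltration k X Y Z (n + d) := by
  refine map_mem (LinearMap.mulLeft k (X ^ d)) d (fun i j l hn => ?_) hx
  rw [LinearMap.mulLeft_apply, ← mul_assoc, ← mul_assoc, ← pow_add]
  exact monomial_mem (by omega)

lemma mul_Y_mem (hYZ : Commute Y Z) (hx : x ∈ weightFiltration k X Y Z n) :
    x * Y ∈ weightFiltration k X Y Z (n + 1) := by
  refine map_mem (LinearMap.mulRight k Y) 1 (fun i j l hn => ?_) hx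
  rw [LinearMap.mulRight_apply, mul_assoc, ← (hYZ.pow_right l).eq, ← mul_assoc, mul_assoc (X ^ i),
    ← pow_succ]
  exact monomial_mem (by omega)

lemma mul_pow_Z_mem (d : ℕ) (hx : x ∈ weightFiltration k X Y Z n) :
    x * Z ^ d ∈ weightFiltration k X Y Z (n + 2 * d) := by
  refine map_mem (LinearMap.mulRight k (Z ^ d)) (2 * d) (fun i j l hn => ?_) hx
  rw [LinearMap.mulRight_apply, mul_assoc, ← pow_add]
  exact monomial_mem (by omega)

lemma mul_Z_mem (hx : x ∈ weightFiltration k X Y Z n) :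
    x * Z ∈ weightFiltration k X Y Z (n + 2) := by
  simpa using mul_pow_Z_mem 1 hx

lemma mem_of_mul_one_add_Z_mem {N : ℕ} (hN : N ≠ 0) (hZ : (1 + Z) ^ N = 1)
    (hx : x * (1 + Z) ∈ weightFiltration k X Y Z n) : x ∈ weightFiltration k X Y Z n := by
  have key (r : ℕ) : x * (1 + Z) ^ (r + 1) ∈ weightFiltration k X Y Z n := by
    induction r with
    | zero => simpa using hx
    | succ r ih =>
      rw [pow_succ, ← mul_assoc, mul_add, mul_one]
      exact add_mem ih (antitone (by omega) (mul_Z_mem ih))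
  obtain ⟨r, rfl⟩ := Nat.exists_eq_succ_of_ne_zero hN
  simpa [hZ] using key r

lemma pow_Y_mul_X_mem {N : ℕ} (hN : N ≠ 0) (hZ : (1 + Z) ^ N = 1)
    (hYZ : Commute Y Z) (hYX : Y * X = X * Y - (1 + Y) * (1 + X) * Z) (j : ℕ) :
    Y ^ j * X ∈ weightFiltration k X Y Z (j + 1) := by
  induction j with
  | zero =>
    simpa using monomial_mem (k := k) (X := X) (Y := Y) (Z := Z) (n := 1)
      (i := 1) (j := 0) (l := 0) (by omega)
  | succ j ih =>
    refine mem_of_mul_one_add_Z_mem hN hZ ?_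
    have hpow (r : ℕ) : Y ^ r ∈ weightFiltration k X Y Z r := by
      simpa using monomial_mem (k := k) (X := X) (Y := Y) (Z := Z) (n := r)
        (i := 0) (j := r) (l := 0) (by omega)
    have expand : Y ^ (j + 1) * X * (1 + Z) =
        Y ^ j * X * Y - (Y ^ j * Z + Y ^ j * X * Z + Y ^ (j + 1) * Z) := by
      have : Y ^ (j + 1) * X = Y ^ j * X * Y -
          (Y ^ j * Z + Y ^ j * X * Z + Y ^ (j + 1) * Z + Y ^ (j + 1) * X * Z) := by
        conv_lhs => rw [pow_succ, mul_assoc, hYX]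
        rw [pow_succ]
        noncomm_ring
      rw [mul_add, mul_one]
      conv_lhs => arg 1; rw [this]
      abel
    rw [expand]
    exact sub_mem (mul_Y_mem hYZ ih)
      (add_mem (add_mem (mul_Z_mem (hpow j)) (antitone (by omega) (mul_Z_mem ih)))
        (antitone (by omega) (mul_Z_mem (hpow (j + 1)))))

lemma mul_X_mem {N : ℕ} (hN : N ≠ 0) (hZ : (1 + Z) ^ N = 1)
    (hXZ : Commute X Z) (hYZ : Commute Y Z) (hYX : Y * X = X * Y - (1 + Y) * (1 + X) * Z)
    (hx : x ∈ weightFiltration k X Y Z n) : x * X ∈ weightFiltration k X Y Z (n + 1) := by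
  refine map_mem (LinearMap.mulRight k X) 1 (fun i j l hn => ?_) hx
  rw [LinearMap.mulRight_apply, mul_assoc, ← (hXZ.pow_right l).eq, ← mul_assoc, mul_assoc (X ^ i)]
  exact antitone (by omega)
    (mul_pow_Z_mem l (pow_X_mul_mem i (pow_Y_mul_X_mem hN hZ hYZ hYX j)))

lemma eq_bot {h : ℕ} (hh : 0 < h) (hYZ : Commute Y Z)
    (hX : X ^ (2 * h) = Z ^ h) (hY : Y ^ (2 * h) = Z ^ h) (hZ : Z ^ (2 * h) = 0) :
    weightFiltration k X Y Z (4 * (2 * h) - 3) = ⊥ := by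
  rw [eq_bot_iff, weightFiltration, Submodule.span_le]
  rintro _ ⟨i, j, l, hn, rfl⟩
  have hi := Nat.mod_lt i (show 0 < 2 * h by omega)
  have hj := Nat.mod_lt j (show 0 < 2 * h by omega)
  have hi' := Nat.mod_add_div i (2 * h)
  have hj' := Nat.mod_add_div j (2 * h)
  have hE : 2 * h ≤ h * (i / (2 * h)) + h * (j / (2 * h)) + l := by
    have e1 : 2 * h * (i / (2 * h)) = 2 * (h * (i / (2 * h))) := by ring
    have e2 : 2 * h * (j / (2 * h)) = 2 * (h * (j / (2 * h))) := by ring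
    omega
  have hzero : Z ^ (h * (i / (2 * h)) + h * (j / (2 * h)) + l) = 0 := by
    rw [← Nat.sub_add_cancel hE, pow_add, hZ, mul_zero]
  have hcomm := ((hYZ.pow_right (h * (i / (2 * h)))).pow_left (j % (2 * h))).eq
  have : X ^ i * Y ^ j * Z ^ l = X ^ (i % (2 * h)) * Y ^ (j % (2 * h)) *
      Z ^ (h * (i / (2 * h)) + h * (j / (2 * h)) + l) := by
    rw [pow_eq_pow_mod_mul hX i, pow_eq_pow_mod_mul hY j, pow_add, pow_add]
    simp only [mul_assoc]
    congr 1
    simp only [← mul_assoc, hcomm]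
  simp [this, hzero]

end weightFiltration

end WeightFiltration

lemma sub_one_pow_two_pow_sub_one {A : Type*} [Ring A] [CharP A 2] (x : A) (n : ℕ) :
    (x - 1) ^ (2 ^ n - 1) = ∑ i ∈ Finset.range (2 ^ n), x ^ i := by
  induction n with
  | zero => simp
  | succ n ih =>
    have e : 2 ^ (n + 1) - 1 = (2 ^ n - 1) + 2 ^ n := by
      have := Nat.one_le_two_pow (n := n)
      omega
    rw [e, pow_add, ih, sub_pow_char_pow_of_commute 2 n (Commute.one_right x), one_pow, pow_succ,
      mul_two, Finset.sum_range_add, CharTwo.sub_eq_add, mul_add, mul_one, add_comm, Finset.sum_mul]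
    simp only [← pow_add, add_comm]

lemma Ideal.pow_mem_pow_mul {A : Type*} [Ring A] {I : Ideal A} [I.IsTwoSided] {x : A} {d : ℕ}
    (hx : x ∈ I ^ d) (n : ℕ) : x ^ n ∈ I ^ (d * n) := by
  induction n with
  | zero => simp [Submodule.pow_zero, Ideal.one_eq_top]
  | succ n ih =>
    rw [mul_add, mul_one, pow_succ, Ideal.IsTwoSided.pow_add]
    exact Ideal.mul_mem_mul ih hx

section GroupAlgebra

variable {G : Type*} [Group G]

/-- The augmentation map of a group algebra. -/
noncomputable def augmentation (k G : Type*) [CommRing k] [Group G] : MonoidAlgebra k G →ₐ[k] k :=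
  MonoidAlgebra.lift k k G 1

open MonoidAlgebra

instance {k : Type*} [Field k] (p : ℕ) [CharP k p] : CharP (MonoidAlgebra k G) p :=
  charP_of_injective_algebraMap (algebraMap k (MonoidAlgebra k G)).injective p

lemma of_sub_one_mem_ker_augmentation (k : Type*) [CommRing k] (g : G) :
    of k G g - 1 ∈ RingHom.ker (augmentation k G) := by
  simp [RingHom.mem_ker, augmentation]

lemma ker_augmentation_le_span_sub_one {k : Type*} [CommRing k] {s : Set G}
    (hs : Subgroup.closure s = ⊤) :
    RingHom.ker (augmentation k G) ≤ Ideal.span ((fun g => of k G g - 1) '' s) := by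
  set M := Ideal.span ((fun g => of k G g - 1) '' s)
  have hof (g : G) : of k G g - 1 ∈ M := by
    have hg : g ∈ Subgroup.closure s := hs ▸ Subgroup.mem_top g
    induction hg using Subgroup.closure_induction with
    | mem x hx => exact Ideal.subset_span ⟨x, hx, rfl⟩
    | one => rw [map_one, sub_self]; exact zero_mem M
    | mul x y _ _ hx hy =>
      have : of k G (x * y) - 1 = of _ G x * (of _ G y - 1) + (of _ G x - 1) := by
        rw [map_mul]; noncomm_ring
      rw [this]
      exact add_mem (M.mul_mem_left _ hy) hx
    | inv x _ hx =>
      have : of k G x⁻¹ - 1 = -(of _ G x⁻¹ * (of _ G x - 1)) := by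
        rw [mul_sub, ← map_mul, inv_mul_cancel, map_one, mul_one, neg_sub]
      rw [this]
      exact neg_mem (M.mul_mem_left _ hx)
  have key (x : MonoidAlgebra k G) : x - algebraMap _ _ (augmentation k G x) ∈ M := by
    induction x using MonoidAlgebra.induction_on with
    | of g =>
      have : augmentation k G (of k G g) = 1 := by simp [augmentation]
      rw [this, map_one]
      exact hof g
    | add x y hx hy => rw [map_add, map_add, add_sub_add_comm]; exact add_mem hx hy
    | smul r x hx =>
      rw [map_smul, smul_eq_mul, map_mul, ← Algebra.smul_def, ← smul_sub, Algebra.smul_def]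
      exact M.mul_mem_left _ hx
  intro x hx
  simpa [RingHom.mem_ker.1 hx] using key x

lemma jacobson_bot_eq_ker_augmentation {k : Type*} [Field k] {N : ℕ}
    (hN : RingHom.ker (augmentation k G) ^ N = ⊥) :
    Ideal.jacobson (⊥ : Ideal (MonoidAlgebra k G)) = RingHom.ker (augmentation k G) := by
  have hmax : (RingHom.ker (augmentation k G)).IsMaximal :=
    RingHom.ker_isMaximal_of_surjective _ fun r => ⟨algebraMap _ _ r, AlgHom.commutes _ r⟩
  refine le_antisymm (sInf_le ⟨bot_le, hmax⟩) fun x hx => ?_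
  rw [Ideal.mem_jacobson_iff]
  intro y
  have hnil : IsNilpotent (y * x) := by
    refine ⟨N, ?_⟩
    have := Ideal.pow_mem_pow (Ideal.mul_mem_left _ y hx) N
    rwa [hN] at this
  obtain ⟨u, hu⟩ := hnil.isUnit_one_add
  refine ⟨↑u⁻¹, ?_⟩
  have : (↑u⁻¹ : MonoidAlgebra k G) * (1 + y * x) = 1 := by
    rw [← hu, Units.inv_mul]
  rw [mul_add, mul_one] at this
  rw [Ideal.mem_bot, sub_eq_zero, mul_assoc, add_comm, this]

end GroupAlgebra

section NormalForm

variable {G : Type*} [Group G] {a b z : G}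

lemma pow_mul_eq_mul_pow_mul_pow (hab : a * b = b * a * z) (hzb : Commute z b)
    {q : ℕ} (hq : 0 < q) (hz : z ^ q = 1) (j : ℕ) :
    b ^ j * a = a * b ^ j * z ^ (j * (q - 1)) := by
  have hzinv : z * z ^ (q - 1) = 1 := by
    rw [← pow_succ', Nat.sub_add_cancel hq, hz]
  have hba : b * a = a * b * z ^ (q - 1) := by rw [hab, mul_assoc, hzinv, mul_one]
  induction j with
  | zero => simp
  | succ j ih =>
    calc b ^ (j + 1) * a = b ^ j * a * b * z ^ (q - 1) := by
          rw [pow_succ, mul_assoc, hba]; simp only [mul_assoc]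
      _ = a * b ^ (j + 1) * z ^ ((j + 1) * (q - 1)) := by
          rw [ih, mul_assoc (a * b ^ j), (hzb.pow_left _).eq, add_mul, one_mul, pow_add z, pow_succ b]
          simp only [mul_assoc]

lemma exists_eq_pow_mul_pow_mul_pow [Finite G] (hgen : Subgroup.closure {a, b} = ⊤)
    (hab : a * b = b * a * z) (hza : Commute z a) (hzb : Commute z b)
    {q : ℕ} (hq : 0 < q) (hz : z ^ q = 1) (g : G) :
    ∃ i j l : ℕ, g = a ^ i * b ^ j * z ^ l := by
  have hg : g ∈ Submonoid.closure {a, b} := by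
    rw [← Subgroup.closure_toSubmonoid_of_finite, hgen]; trivial
  induction hg using Submonoid.closure_induction_right with
  | one => exact ⟨0, 0, 0, by simp⟩
  | mul_right x _ y hy ih =>
    obtain ⟨i, j, l, rfl⟩ := ih
    rcases hy with rfl | rfl
    · refine ⟨i + 1, j, j * (q - 1) + l, ?_⟩
      rw [mul_assoc, (hza.pow_left l).eq, ← mul_assoc, mul_assoc (y ^ i),
        pow_mul_eq_mul_pow_mul_pow hab hzb hq hz, pow_add _ (j * (q - 1)),
        pow_succ]
      simp only [mul_assoc]
    · refine ⟨i, j + 1, l, ?_⟩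
      rw [mul_assoc, (hzb.pow_left l).eq, pow_succ]
      simp only [mul_assoc]

lemma bijective_normalForm [Fintype G] (hgen : Subgroup.closure {a, b} = ⊤)
    (hab : a * b = b * a * z) (hza : Commute z a) (hzb : Commute z b)
    {q h : ℕ} (hq : 0 < q) (hz : z ^ q = 1) (haq : a ^ q = z ^ h) (hbq : b ^ q = z ^ h)
    (hcard : Fintype.card G = q ^ 3) :
    Function.Bijective fun t : Fin q × Fin q × Fin q =>
      a ^ (t.1 : ℕ) * b ^ (t.2.1 : ℕ) * z ^ (t.2.2 : ℕ) := by
  rw [Fintype.bijective_iff_surjective_and_card]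
  refine ⟨fun g => ?_, by simp only [Fintype.card_prod, Fintype.card_fin, hcard]; ring⟩
  obtain ⟨i, j, l, rfl⟩ := exists_eq_pow_mul_pow_mul_pow hgen hab hza hzb hq hz g
  refine ⟨(⟨i % q, Nat.mod_lt _ hq⟩, ⟨j % q, Nat.mod_lt _ hq⟩,
    ⟨(h * (i / q) + h * (j / q) + l) % q, Nat.mod_lt _ hq⟩), ?_⟩
  have hmod : z ^ ((h * (i / q) + h * (j / q) + l) % q) =
      z ^ (h * (i / q) + h * (j / q) + l) := by
    conv_rhs => rw [← Nat.mod_add_div (h * (i / q) + h * (j / q) + l) q, pow_add, pow_mul, hz,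
      one_pow, mul_one]
  have hcomm := ((hzb.pow_left (h * (i / q))).pow_right (j % q)).eq
  simp only [hmod]
  rw [pow_eq_pow_mod_mul haq i, pow_eq_pow_mod_mul hbq j, pow_add, pow_add]
  simp only [mul_assoc]
  congr 1
  simp only [← mul_assoc, hcomm]

end NormalForm

section LoewyLength

variable {G : Type*} [Group G] {a b z : G}

open MonoidAlgebra

lemma ker_augmentation_pow_le_weightFiltration [Finite G] {k : Type*} [CommRing k]
    (hgen : Subgroup.closure {a, b} = ⊤) (hab : a * b = b * a * z)
    (hza : Commute z a) (hzb : Commute z b) {q : ℕ} (hq : 0 < q) (hz : z ^ q = 1) (n : ℕ) :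
    ∀ x ∈ RingHom.ker (augmentation k G) ^ n,
      x ∈ weightFiltration k (of k G a - 1) (of k G b - 1) (of k G z - 1) n := by
  set X := of k G a - 1 with hX
  set Y := of k G b - 1 with hY
  set Z := of k G z - 1 with hZ
  have hXZ : Commute X Z :=
    (((hza.symm.map (of k G)).sub_left (Commute.one_left _)).sub_right (Commute.one_right _))
  have hYZ : Commute Y Z :=
    (((hzb.symm.map (of k G)).sub_left (Commute.one_left _)).sub_right (Commute.one_right _))
  have hZq : (1 + Z) ^ q = 1 := by rw [hZ, add_sub_cancel, ← map_pow, hz, map_one]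
  have hYX : Y * X = X * Y - (1 + Y) * (1 + X) * Z := by
    have : of k G a * of k G b = of k G b * of k G a * of k G z := by
      simp only [← map_mul, hab]
    rw [hX, hY, hZ]
    simp only [add_sub_cancel, mul_sub, sub_mul, this, mul_one, one_mul]
    abel
  have hmulX {n : ℕ} {x} := weightFiltration.mul_X_mem (k := k) (n := n) (x := x)
    hq.ne' hZq hXZ hYZ hYX
  have hmulY {n : ℕ} {x} := weightFiltration.mul_Y_mem (k := k) (X := X) (n := n) (x := x) hYZ
  induction n with
  | zero =>
    intro x hx
    clear hx
    induction x using MonoidAlgebra.induction_on with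
    | of g =>
      have hg : g ∈ Submonoid.closure {a, b} := by
        rw [← Subgroup.closure_toSubmonoid_of_finite, hgen]; trivial
      induction hg using Submonoid.closure_induction_right with
      | one =>
        rw [map_one]
        simpa using weightFiltration.monomial_mem (k := k) (X := X) (Y := Y) (Z := Z) (n := 0)
          (i := 0) (j := 0) (l := 0) (by omega)
      | mul_right g _ y hy ih =>
        rw [map_mul]
        rcases hy with rfl | rfl
        · rw [← sub_add_cancel (of k G y) 1, mul_add, mul_one]
          exact add_mem (weightFiltration.antitone (by omega) (hmulX ih)) ih
        · rw [← sub_add_cancel (of k G y) 1, mul_add, mul_one]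
          exact add_mem (weightFiltration.antitone (by omega) (hmulY ih)) ih
    | add x y hx hy => exact add_mem hx hy
    | smul r x hx => exact Submodule.smul_mem _ _ hx
  | succ n ih =>
    intro x hx
    rw [Submodule.pow_succ] at hx
    induction hx using Submodule.mul_induction_on' with
    | mem_mul_mem u hu v hv =>
      have hv' : v ∈ Ideal.span {X, Y} := by
        have := ker_augmentation_le_span_sub_one hgen hv
        rwa [Set.image_pair] at this
      obtain ⟨r, s, rfl⟩ := Ideal.mem_span_pair.1 hv'
      rw [mul_add, ← mul_assoc, ← mul_assoc]
      exact add_mem (hmulX (ih _ (Ideal.mul_mem_right _ _ hu)))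
        (hmulY (ih _ (Ideal.mul_mem_right _ _ hu)))
    | add u _ v _ hu hv => exact add_mem hu hv

lemma ker_augmentation_pow_eq_bot [Finite G]
    (hgen : Subgroup.closure {a, b} = ⊤) (hab : a * b = b * a * z)
    (hza : Commute z a) (hzb : Commute z b) {m : ℕ} (hz : z ^ 2 ^ (m + 1) = 1)
    (haq : a ^ 2 ^ (m + 1) = z ^ 2 ^ m) (hbq : b ^ 2 ^ (m + 1) = z ^ 2 ^ m) :
    RingHom.ker (augmentation (ZMod 2) G) ^ (2 ^ (m + 3) - 3) = ⊥ := by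
  have hpow (g : G) (r : ℕ) :
      (of (ZMod 2) G g - 1) ^ 2 ^ r = of (ZMod 2) G (g ^ 2 ^ r) - 1 := by
    rw [sub_pow_char_pow_of_commute 2 r (Commute.one_right _), one_pow, map_pow]
  have hYZ : Commute (of (ZMod 2) G b - 1) (of (ZMod 2) G z - 1) :=
    ((hzb.symm.map (of _ G)).sub_left (Commute.one_left _)).sub_right (Commute.one_right _)
  have hbot := weightFiltration.eq_bot (k := ZMod 2) (X := of (ZMod 2) G a - 1) (h := 2 ^ m)
    (by positivity) hYZ
    (by rw [← pow_succ', hpow, hpow, haq]) (by rw [← pow_succ', hpow, hpow, hbq])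
    (by rw [← pow_succ', hpow, hz, map_one, sub_self])
  have e : 2 ^ (m + 3) - 3 = 4 * (2 * 2 ^ m) - 3 := by rw [pow_add]; omega
  rw [eq_bot_iff, e]
  intro x hx
  have := ker_augmentation_pow_le_weightFiltration hgen hab hza hzb (by positivity) hz _ x hx
  rwa [hbot] at this

lemma ker_augmentation_pow_ne_bot [Fintype G]
    (hgen : Subgroup.closure {a, b} = ⊤) (hab : a * b = b * a * z)
    (hza : Commute z a) (hzb : Commute z b) {m h : ℕ} (hz : z ^ 2 ^ m = 1)
    (haq : a ^ 2 ^ m = z ^ h) (hbq : b ^ 2 ^ m = z ^ h)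
    (hcard : Fintype.card G = (2 ^ m) ^ 3) :
    RingHom.ker (augmentation (ZMod 2) G) ^ (4 * (2 ^ m - 1)) ≠ ⊥ := by
  set I := RingHom.ker (augmentation (ZMod 2) G)
  set F := of (ZMod 2) G
  have hI (g : G) : F g - 1 ∈ I := of_sub_one_mem_ker_augmentation (ZMod 2) g
  have hZ : F z - 1 ∈ I ^ 2 := by
    have hcomm : (F a - 1) * (F b - 1) - (F b - 1) * (F a - 1) = F (b * a) * (F z - 1) := by
      have : F a * F b = F (b * a) * F z := by simp only [← map_mul, hab]
      simp only [mul_sub, sub_mul, this, mul_one, one_mul, map_mul]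
      abel
    have : F z - 1 =
        F (b * a)⁻¹ * ((F a - 1) * (F b - 1) - (F b - 1) * (F a - 1)) := by
      rw [hcomm, ← mul_assoc, ← map_mul, inv_mul_cancel, map_one, one_mul]
    rw [this, show I ^ 2 = I ^ 1 * I from Submodule.pow_succ I, Submodule.pow_one]
    exact Ideal.mul_mem_left _ _
      (sub_mem (Ideal.mul_mem_mul (hI a) (hI b)) (Ideal.mul_mem_mul (hI b) (hI a)))
  have hmem : (F a - 1) ^ (2 ^ m - 1) * (F b - 1) ^ (2 ^ m - 1) * (F z - 1) ^ (2 ^ m - 1) ∈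
      I ^ (4 * (2 ^ m - 1)) := by
    have e : 4 * (2 ^ m - 1) = (2 ^ m - 1) + (2 ^ m - 1) + 2 * (2 ^ m - 1) := by ring
    rw [e, Ideal.IsTwoSided.pow_add, Ideal.IsTwoSided.pow_add]
    exact Ideal.mul_mem_mul (Ideal.mul_mem_mul (Ideal.pow_mem_pow (hI a) _)
      (Ideal.pow_mem_pow (hI b) _)) (Ideal.pow_mem_pow_mul hZ _)
  have hsum : (F a - 1) ^ (2 ^ m - 1) * (F b - 1) ^ (2 ^ m - 1) * (F z - 1) ^ (2 ^ m - 1) =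
      ∑ g : G, single g (1 : ZMod 2) := by
    rw [sub_one_pow_two_pow_sub_one, sub_one_pow_two_pow_sub_one, sub_one_pow_two_pow_sub_one,
      ← (bijective_normalForm hgen hab hza hzb (by positivity) hz haq hbq hcard).sum_comp]
    simp only [← of_apply, map_mul, map_pow, Fintype.sum_prod_type, Finset.sum_range]
    rw [Finset.sum_mul_sum, Finset.sum_mul]
    simp only [Finset.sum_mul, Finset.mul_sum]
    exact Finset.sum_congr rfl fun _ _ => Finset.sum_comm
  intro hbot
  rw [hbot, hsum, Ideal.mem_bot] at hmem
  have := congrArg (fun f => f.coeff 1) hmem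
  simp at this

lemma loewyLength_eq_of_ker_augmentation_pow {p : ℕ} [Fact p.Prime] {n : ℕ} (hn : 0 < n)
    (hbot : RingHom.ker (augmentation (ZMod p) G) ^ n = ⊥)
    (hne : RingHom.ker (augmentation (ZMod p) G) ^ (n - 1) ≠ ⊥) : loewyLength p G = n := by
  rw [loewyLength, jacobson_bot_eq_ker_augmentation hbot]
  refine le_antisymm (Nat.sInf_le ⟨hn, hbot⟩) (le_csInf ⟨n, hn, hbot⟩ ?_)
  rintro r ⟨-, hr⟩
  by_contra! hlt
  exact hne (eq_bot_iff.2 (hr ▸ Ideal.pow_le_pow_right (by omega)))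

end LoewyLength

/-- For the group `G₄ = (⟨c⟩ × ⟨a⟩)⟨b⟩` with `o(a) = o(b) = 2^(γ+1)`,
`o([a,b]) = 2^γ`, `o(c) = 2^(γ−1)`, `[a,b] = a² c`, `[c,b] = a⁻⁴ c⁻²`,
`a^(2^γ) = b^(2^γ)` and `γ ≥ 1`, the Loewy length satisfies `L(G) = 2^(γ+2) - 3`. -/
theorem loewyLength_G4 (γ : ℕ) (hγ : 1 ≤ γ)
    (G : Type*) [Group G] [Fintype G] (a b c : G)
    (hcard : Fintype.card G = 2 ^ (3 * γ))
    (hgen : Subgroup.closure {a, b, c} = ⊤)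
    (hac : a * c = c * a)
    (hoa : orderOf a = 2 ^ (γ + 1)) (hob : orderOf b = 2 ^ (γ + 1))
    (hoc : orderOf c = 2 ^ (γ - 1))
    (hoab : orderOf (a⁻¹ * b⁻¹ * a * b) = 2 ^ γ)
    (hab : a⁻¹ * b⁻¹ * a * b = a ^ 2 * c)
    (hcb : c⁻¹ * b⁻¹ * c * b = a ^ (-4 : ℤ) * c ^ (-2 : ℤ))
    (hpow : a ^ 2 ^ γ = b ^ 2 ^ γ) :
    loewyLength 2 G = 2 ^ (γ + 2) - 3 := by
  obtain ⟨m, rfl⟩ := Nat.exists_eq_add_of_le' hγ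
  have hac' : Commute a c := hac
  obtain ⟨z, hz⟩ : ∃ z, z = a ^ 2 * c := ⟨_, rfl⟩
  have hza : Commute z a := hz ▸ ((Commute.refl a).pow_left 2).mul_left hac'.symm
  have hba : b⁻¹ * a * b = a * z := by
    rw [hz, ← hab]; group
  have hbc : b⁻¹ * c * b = a ^ (-4 : ℤ) * c⁻¹ := by
    have : b⁻¹ * c * b = c * (a ^ (-4 : ℤ) * c ^ (-2 : ℤ)) := by rw [← hcb]; group
    rw [this, ← mul_assoc, (hac'.symm.zpow_right (-4)).eq]
    group
  have hbz : b⁻¹ * z * b = z := by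
    have h1 : b⁻¹ * z * b = (b⁻¹ * a * b) ^ 2 * (b⁻¹ * c * b) := by
      rw [hz, pow_two, pow_two]; group
    have h2 : (a * z) ^ 2 = a ^ 2 * z ^ 2 := hza.symm.mul_pow 2
    have h3 : z ^ 2 = a ^ 4 * c ^ 2 := by
      rw [hz, (hac'.pow_left 2).mul_pow, ← pow_mul]
    rw [h1, hba, hbc, h2, h3]
    have h4 : c ^ 2 * a ^ (-4 : ℤ) = a ^ (-4 : ℤ) * c ^ 2 :=
      ((hac'.zpow_left (-4)).pow_right 2).symm.eq
    calc a ^ 2 * (a ^ 4 * c ^ 2) * (a ^ (-4 : ℤ) * c⁻¹)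
        = a ^ 2 * a ^ 4 * (c ^ 2 * a ^ (-4 : ℤ)) * c⁻¹ := by simp only [mul_assoc]
      _ = a ^ 2 * c := by rw [h4]; group
      _ = z := hz.symm
  have hzb : Commute z b := by
    have := congrArg (b * ·) hbz
    simpa [mul_assoc, commute_iff_eq] using this
  have hab' : a * b = b * a * z := by
    rw [mul_assoc, ← hba]; group
  have hc : c = (a ^ 2)⁻¹ * z := by rw [hz]; group
  have hgen' : Subgroup.closure {a, b} = ⊤ := by
    rw [eq_top_iff, ← hgen, Subgroup.closure_le]
    have ha : a ∈ Subgroup.closure {a, b} := Subgroup.subset_closure (by simp)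
    have hb : b ∈ Subgroup.closure {a, b} := Subgroup.subset_closure (by simp)
    rintro x (rfl | rfl | rfl)
    · exact ha
    · exact hb
    · rw [hc, hz, ← hab]
      exact mul_mem (inv_mem (pow_mem ha 2))
        (mul_mem (mul_mem (mul_mem (inv_mem ha) (inv_mem hb)) ha) hb)
  have hzq : z ^ 2 ^ (m + 1) = 1 := by rw [hz, ← hab, ← hoab, pow_orderOf_eq_one]
  have haq : a ^ 2 ^ (m + 1) = z ^ 2 ^ m := by
    have hc1 : c ^ 2 ^ m = 1 := by
      rw [← pow_orderOf_eq_one c, hoc, Nat.add_sub_cancel]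
    rw [hz, (hac'.pow_left 2).mul_pow, hc1, mul_one, ← pow_mul, pow_succ']
  have hbq : b ^ 2 ^ (m + 1) = z ^ 2 ^ m := hpow ▸ haq
  have hlt : 2 ≤ 2 ^ (m + 1) := Nat.le_self_pow (by omega) 2
  have e : 2 ^ (m + 1 + 2) = 4 * 2 ^ (m + 1) := by ring
  refine loewyLength_eq_of_ker_augmentation_pow (by omega)
    (ker_augmentation_pow_eq_bot hgen' hab' hza hzb hzq haq hbq) ?_
  have := ker_augmentation_pow_ne_bot hgen' hab' hza hzb hzq haq hbq
    (by rw [hcard, ← pow_mul]; ring)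
  have e' : 2 ^ (m + 1 + 2) - 3 - 1 = 4 * (2 ^ (m + 1) - 1) := by omega
  rwa [e']
end
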